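/- For every d ≥ 4 there is no full-dimensional strictly bipartite convex polytope in ℝ^d. -/

import Mathlib

open Set Pointwise

noncomputable section

/-- Euclidean space `ℝ^d`. -/
abbrev Euc (d : ℕ) := EuclideanSpace ℝ (Fin d)

/-- A convex polytope: the convex hull of a finite set of points. -/
def IsPolytope {d : ℕ} (P : Set (Euc d)) : Prop :=
  ∃ S : Finset (Euc d), P = convexHull ℝ (S : Set (Euc d))

/-- `P` is full-dimensional: its affine span is all of `ℝ^d`. -/
def FullDim {d : ℕ} (P : Set (Euc d)) : Prop :=
  affineSpan ℝ P = ⊤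

/-- `[v,w]` is an edge of `P`: an exposed face of `P` which is a segment with `v ≠ w`. -/
def IsEdge {d : ℕ} (P : Set (Euc d)) (v w : Euc d) : Prop :=
  v ≠ w ∧ IsExposed ℝ P (segment ℝ v w)

/-- `e` is an edge of `P`, as a set. -/
def IsEdgeSet {d : ℕ} (P e : Set (Euc d)) : Prop :=
  ∃ v w : Euc d, IsEdge P v w ∧ e = segment ℝ v w

/-- `T` is a symmetry of `P`: a linear isometry mapping `P` onto itself. -/
def IsAut {d : ℕ} (P : Set (Euc d)) (T : Euc d ≃ₗᵢ[ℝ] Euc d) : Prop :=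
  T '' P = P

/-- `P` is vertex-transitive: any vertex (extreme point) can be mapped onto any
other by a symmetry of `P`. -/
def VertexTransitive {d : ℕ} (P : Set (Euc d)) : Prop :=
  ∀ v ∈ Set.extremePoints ℝ P, ∀ w ∈ Set.extremePoints ℝ P,
    ∃ T : Euc d ≃ₗᵢ[ℝ] Euc d, IsAut P T ∧ T v = w

/-- `P` is edge-transitive: any edge can be mapped onto any other by a symmetry of `P`. -/
def EdgeTransitive {d : ℕ} (P : Set (Euc d)) : Prop :=
  ∀ e e' : Set (Euc d), IsEdgeSet P e → IsEdgeSet P e' →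
    ∃ T : Euc d ≃ₗᵢ[ℝ] Euc d, IsAut P T ∧ T '' e = e'

/-- `P` is bipartite with vertex partition `V1, V2`, radii `r1 ≤ r2` and edge length `ℓ`:
all edges have length `ℓ`, every edge joins `V1` to `V2`, where `V1 ⊔ V2` is a partition of
the vertex set, and vertices in `Vᵢ` have norm `rᵢ`. -/
def IsBipartiteWith {d : ℕ} (P V1 V2 : Set (Euc d)) (r1 r2 ℓ : ℝ) : Prop :=
  (0 < ℓ) ∧ (∀ v w : Euc d, IsEdge P v w → ‖v - w‖ = ℓ) ∧
  (V1 ∪ V2 = Set.extremePoints ℝ P) ∧ Disjoint V1 V2 ∧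
  (∀ v w : Euc d, IsEdge P v w → (v ∈ V1 ∧ w ∈ V2) ∨ (v ∈ V2 ∧ w ∈ V1)) ∧
  (0 < r1) ∧ (r1 ≤ r2) ∧ (∀ v ∈ V1, ‖v‖ = r1) ∧ (∀ v ∈ V2, ‖v‖ = r2)

/-- `P` is a bipartite polytope. -/
def IsBipartite {d : ℕ} (P : Set (Euc d)) : Prop :=
  ∃ (V1 V2 : Set (Euc d)) (r1 r2 ℓ : ℝ), IsBipartiteWith P V1 V2 r1 r2 ℓ

/-- `P` is a strictly bipartite polytope (`r1 < r2`). -/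
def IsStrictlyBipartite {d : ℕ} (P : Set (Euc d)) : Prop :=
  ∃ (V1 V2 : Set (Euc d)) (r1 r2 ℓ : ℝ), IsBipartiteWith P V1 V2 r1 r2 ℓ ∧ r1 < r2

open scoped RealInnerProductSpace

section FiniteExposed

variable {E : Type*} [NormedAddCommGroup E] [InnerProductSpace ℝ E]

/-- Every point of `V` is the unique maximizer over `V` of some linear functional. -/
def ExposedPoints (V : Set E) : Prop :=
  ∀ x ∈ V, ∃ a : E, ∀ y ∈ V, y ≠ x → ⟪a, y⟫ < ⟪a, x⟫

/-- `x` and `y` are exactly the maximizers over `V` of some linear functional. -/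
def Adj (V : Set E) (x y : E) : Prop :=
  x ∈ V ∧ y ∈ V ∧ x ≠ y ∧ ∃ a : E, ⟪a, x⟫ = ⟪a, y⟫ ∧ ∀ z ∈ V, z ≠ x → z ≠ y → ⟪a, z⟫ < ⟪a, x⟫

/-- `F` is the set of maximizers over `V` of some linear functional. -/
def IsFace (V F : Set E) : Prop :=
  ∃ (a : E) (m : ℝ), (∀ x ∈ V, ⟪a, x⟫ ≤ m) ∧ F = {x | x ∈ V ∧ ⟪a, x⟫ = m}

/-- The edge directions of `V` at `x`. -/
def dirs (V : Set E) (x : E) : Set E := (fun y => y - x) '' {y | Adj V x y}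

theorem Adj.symm {V : Set E} {x y : E} (h : Adj V x y) : Adj V y x := by
  obtain ⟨hx, hy, hne, a, ha, hz⟩ := h
  exact ⟨hy, hx, hne.symm, a, ha.symm, fun z hzV h1 h2 => ha ▸ hz z hzV h2 h1⟩

theorem Adj.mono {V F : Set E} {x y : E} (h : Adj V x y) (hF : F ⊆ V) (hx : x ∈ F) (hy : y ∈ F) :
    Adj F x y :=
  ⟨hx, hy, h.2.2.1, h.2.2.2.imp fun _ ha => ⟨ha.1, fun z hz => ha.2 z (hF hz)⟩⟩

theorem ExposedPoints.mono {V F : Set E} (h : ExposedPoints V) (hF : F ⊆ V) : ExposedPoints F :=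
  fun x hx => (h x (hF hx)).imp fun _ ha y hy => ha y (hF hy)

theorem IsFace.subset {V F : Set E} (h : IsFace V F) : F ⊆ V := by
  obtain ⟨a, m, -, rfl⟩ := h
  exact fun x hx => hx.1

theorem exists_mul_bound {α : Type*} {V : Set α} (hV : V.Finite) (p q : α → ℝ) :
    ∃ N : ℝ, ∀ z ∈ V, 0 < p z → q z < N * p z := by
  obtain ⟨M, hM⟩ := (hV.image fun z => q z / p z).bddAbove
  refine ⟨M + 1, fun z hz hp => ?_⟩
  have h1 : q z / p z ≤ M := hM (mem_image_of_mem _ hz)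
  rw [div_le_iff₀ hp] at h1
  linarith

theorem IsFace.adj {V F : Set E} (hV : V.Finite) (hF : IsFace V F) {x y : E} (h : Adj F x y) :
    Adj V x y := by
  obtain ⟨a, m, ham, rfl⟩ := hF
  obtain ⟨hx, hy, hne, b, hb, hz⟩ := h
  obtain ⟨N, hN⟩ := exists_mul_bound hV (fun z => m - ⟪a, z⟫) (fun z => ⟪b, z⟫ - ⟪b, x⟫)
  refine ⟨hx.1, hy.1, hne, N • a + b, ?_, fun z hzV h1 h2 => ?_⟩
  · simp only [inner_add_left, real_inner_smul_left]
    rw [hx.2, hy.2, hb]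
  · simp only [inner_add_left, real_inner_smul_left]
    rw [hx.2]
    rcases (ham z hzV).lt_or_eq with h3 | h3
    · have := hN z hzV (by simpa using h3)
      linarith
    · have := hz z ⟨hzV, h3⟩ h1 h2
      rw [h3]
      linarith

/-- A vertex which is not the only vertex has an edge. -/
theorem exists_adj {V : Set E} (hV : V.Finite) (he : ExposedPoints V) {v x : E} (hv : v ∈ V)
    (hx : x ∈ V) (hxv : x ≠ v) : ∃ y, Adj V v y := by
  obtain ⟨g, hg⟩ := he v hv
  let t : E → ℝ := fun z => ⟪g, v⟫ - ⟪g, z⟫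
  have ht : ∀ z ∈ V, z ≠ v → 0 < t z := fun z hz hzv => sub_pos.2 (hg z hz hzv)
  let π : E → E := fun z => (t z)⁻¹ • (z - v)
  obtain ⟨y, ⟨hyV, hyv⟩, hmax⟩ := (hV.subset (sdiff_subset (t := {v}))).exists_maximalFor
    (fun z => ‖π z‖) _ ⟨x, hx, hxv⟩
  have hmax' : ∀ z ∈ V, z ≠ v → ‖π z‖ ≤ ‖π y‖ := fun z hz hzv => by
    rcases le_total ‖π z‖ ‖π y‖ with h | h
    · exact h
    · exact hmax ⟨hz, hzv⟩ h
  have hpi : ∀ z ∈ V, z ≠ v → z = v + t z • π z := fun z hz hzv => by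
    simp [π, smul_smul, mul_inv_cancel₀ (ht z hz hzv).ne']
  have hval : ∀ z ∈ V, z ≠ v → ⟪π y + ‖π y‖ ^ 2 • g, z⟫ - ⟪π y + ‖π y‖ ^ 2 • g, v⟫
      = t z * (⟪π y, π z⟫ - ‖π y‖ ^ 2) := fun z hz hzv => by
    have h1 : ⟪π y, z⟫ = ⟪π y, v⟫ + t z * ⟪π y, π z⟫ := by
      conv_lhs => rw [hpi z hz hzv]
      rw [inner_add_right, real_inner_smul_right]
    simp only [inner_add_left, real_inner_smul_left, h1, t]
    ring
  refine ⟨y, hv, hyV, fun h => hyv h.symm, π y + ‖π y‖ ^ 2 • g, ?_, fun z hz hzv hzy => ?_⟩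
  · have := hval y hyV hyv
    rw [real_inner_self_eq_norm_sq] at this
    linarith
  · have h0 := ht z hz hzv
    have h1 := hval z hz hzv
    have h2 : ⟪π y, π z⟫ - ‖π y‖ ^ 2 < 0 := by
      by_contra! h
      have h3 := hmax' z hz hzv
      have h4 : ‖π z - π y‖ ^ 2 ≤ 0 := by
        rw [norm_sub_sq_real, real_inner_comm]
        nlinarith [norm_nonneg (π z), norm_nonneg (π y)]
      have h5 : π z = π y := by
        rw [← sub_eq_zero, ← norm_eq_zero]
        nlinarith [norm_nonneg (π z - π y)]
      have h6 : ∀ b, ⟪b, z⟫ = ⟪b, v⟫ + t z * ⟪b, π y⟫ := fun b => by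
        conv_lhs => rw [hpi z hz hzv, h5]
        rw [inner_add_right, real_inner_smul_right]
      have h7 : ∀ b, ⟪b, y⟫ = ⟪b, v⟫ + t y * ⟪b, π y⟫ := fun b => by
        conv_lhs => rw [hpi y hyV hyv]
        rw [inner_add_right, real_inner_smul_right]
      have hty := ht y hyV hyv
      rcases lt_trichotomy (t z) (t y) with hlt | heq | hgt
      · obtain ⟨b, hb⟩ := he z hz
        have e1 := hb v hv (Ne.symm hzv)
        have e2 := hb y hyV (Ne.symm hzy)
        rw [h6] at e1 e2
        rw [h7] at e2
        nlinarith
      · exact hzy ((hpi z hz hzv).trans (by rw [h5, heq]; exact (hpi y hyV hyv).symm))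
      · obtain ⟨b, hb⟩ := he y hyV
        have e1 := hb v hv (Ne.symm hyv)
        have e2 := hb z hz hzy
        rw [h7] at e1 e2
        rw [h6] at e2
        nlinarith
    nlinarith

/-- A local maximum of a linear functional is a global maximum. -/
theorem le_of_forall_adj_le {V : Set E} (hV : V.Finite) (he : ExposedPoints V) {v f : E}
    (hv : v ∈ V) (h : ∀ y, Adj V v y → ⟪f, y⟫ ≤ ⟪f, v⟫) : ∀ x ∈ V, ⟪f, x⟫ ≤ ⟪f, v⟫ := by
  by_contra! hcon
  obtain ⟨x, hx, hfx⟩ := hcon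
  obtain ⟨g, hg⟩ := he v hv
  let t : E → ℝ := fun z => ⟪g, v⟫ - ⟪g, z⟫
  have ht : ∀ z ∈ V, z ≠ v → 0 < t z := fun z hz hzv => sub_pos.2 (hg z hz hzv)
  have hxv : x ≠ v := fun h => by simp [h] at hfx
  obtain ⟨y, ⟨hyV, hyv⟩, hmax⟩ := exists_max_image (V \ {v}) (fun z => (⟪f, z⟫ - ⟪f, v⟫) / t z)
    (hV.subset sdiff_subset) ⟨x, hx, hxv⟩
  replace hyv : y ≠ v := hyv
  set T := (⟪f, y⟫ - ⟪f, v⟫) / t y with hT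
  have hT0 : 0 < T := lt_of_lt_of_le (div_pos (sub_pos.2 hfx) (ht x hx hxv)) (hmax x ⟨hx, hxv⟩)
  have hTy : ⟪f, y⟫ - ⟪f, v⟫ = T * t y := by
    rw [hT, div_mul_cancel₀ _ (ht y hyV hyv).ne']
  have hTz : ∀ z ∈ V, z ≠ v → ⟪f, z⟫ - ⟪f, v⟫ ≤ T * t z := fun z hz hzv =>
    (div_le_iff₀ (ht z hz hzv)).1 (hmax z ⟨hz, hzv⟩)
  let F : Set E := {z | z ∈ V ∧ ⟪f + T • g, z⟫ = ⟪f + T • g, v⟫}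
  have hF : IsFace V F := by
    refine ⟨f + T • g, ⟪f + T • g, v⟫, fun z hz => ?_, rfl⟩
    by_cases hzv : z = v
    · rw [hzv]
    · have := hTz z hz hzv
      simp only [inner_add_left, real_inner_smul_left, t] at this ⊢
      linarith
  have hyF : y ∈ F := by
    refine ⟨hyV, ?_⟩
    simp only [inner_add_left, real_inner_smul_left, t] at hTy ⊢
    linarith
  obtain ⟨w, hw⟩ := exists_adj (hV.subset hF.subset) (he.mono hF.subset) (v := v) (x := y)
    ⟨hv, rfl⟩ hyF hyv
  have h1 := h w (hF.adj hV hw)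
  have h2 : w ∈ F := hw.2.1
  have h3 := h2.2
  have h4 := mul_pos hT0 (ht w h2.1 hw.2.2.1.symm)
  simp only [inner_add_left, real_inner_smul_left, t] at h3 h4
  linarith

theorem lt_of_forall_adj_lt {V : Set E} (hV : V.Finite) (he : ExposedPoints V) {v f : E}
    (hv : v ∈ V) (h : ∀ y, Adj V v y → ⟪f, y⟫ < ⟪f, v⟫) : ∀ x ∈ V, x ≠ v → ⟪f, x⟫ < ⟪f, v⟫ := by
  have hle := le_of_forall_adj_le hV he hv fun y hy => (h y hy).le
  intro x hx hxv
  refine (hle x hx).lt_of_ne fun heq => ?_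
  have hF : IsFace V {z | z ∈ V ∧ ⟪f, z⟫ = ⟪f, v⟫} := ⟨f, _, hle, rfl⟩
  obtain ⟨w, hw⟩ := exists_adj (hV.subset hF.subset) (he.mono hF.subset) (v := v) (x := x)
    ⟨hv, rfl⟩ ⟨hx, heq⟩ hxv
  have h1 := h w (hF.adj hV hw)
  have h2 := hw.2.1.2
  linarith

/-- If a functional is at most `m` on the neighbours of `v`, and larger at `v`, then it is at most
`m` at all other vertices. -/
theorem le_of_forall_adj_le_of_lt {V : Set E} (hV : V.Finite) (he : ExposedPoints V) {v f : E}
    {m : ℝ} (hv : v ∈ V) (h : ∀ y, Adj V v y → ⟪f, y⟫ ≤ m) (hm : m < ⟪f, v⟫) :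
    ∀ x ∈ V, x ≠ v → ⟪f, x⟫ ≤ m := by
  intro x hx hxv
  obtain ⟨y, ⟨hyV, hyv⟩, hmax⟩ := exists_max_image (V \ {v}) (fun z => ⟪f, z⟫)
    (hV.subset sdiff_subset) ⟨x, hx, hxv⟩
  refine (hmax x ⟨hx, hxv⟩).trans ?_
  by_contra! hlt
  have hglob := lt_of_forall_adj_lt hV he hv (fun z hz => (h z hz).trans_lt hm) y hyV hyv
  have hloc := le_of_forall_adj_le hV he (f := f) hyV (fun z hz => by
    by_cases hzv : z = v
    · subst hzv
      exact absurd (h y hz.symm) (not_le.2 hlt)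
    · exact hmax z ⟨hz.2.1, hzv⟩) v hv
  linarith

theorem dirs_subset_span {V : Set E} (v : E) :
    dirs V v ⊆ Submodule.span ℝ ((fun y => y - v) '' V) := by
  rintro _ ⟨y, hy, rfl⟩
  exact Submodule.subset_span ⟨y, hy.2.1, rfl⟩

/-- The edge directions at a vertex span all directions. -/
theorem sub_mem_span_dirs [FiniteDimensional ℝ E] {V : Set E} (hV : V.Finite)
    (he : ExposedPoints V) {v x : E} (hv : v ∈ V) (hx : x ∈ V) :
    x - v ∈ Submodule.span ℝ (dirs V v) := by
  rw [← Submodule.orthogonal_orthogonal (Submodule.span ℝ (dirs V v)), Submodule.mem_orthogonal]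
  intro a ha
  have h0 : ∀ y, Adj V v y → ⟪a, y⟫ = ⟪a, v⟫ := fun y hy => by
    have := (Submodule.mem_orthogonal' _ _).1 ha _ (Submodule.subset_span ⟨y, hy, rfl⟩)
    rwa [inner_sub_right, sub_eq_zero] at this
  have h1 := le_of_forall_adj_le hV he (f := a) hv (fun y hy => (h0 y hy).le) x hx
  have h2 := le_of_forall_adj_le hV he (f := -a) hv
    (fun y hy => by simp [h0 y hy]) x hx
  simp only [inner_neg_left] at h2
  rw [inner_sub_right]
  linarith

theorem span_dirs [FiniteDimensional ℝ E] {V : Set E} (hV : V.Finite) (he : ExposedPoints V)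
    {v : E} (hv : v ∈ V) :
    Submodule.span ℝ (dirs V v) = Submodule.span ℝ ((fun y => y - v) '' V) := by
  refine le_antisymm (Submodule.span_le.2 (dirs_subset_span v)) (Submodule.span_le.2 ?_)
  rintro _ ⟨x, hx, rfl⟩
  exact sub_mem_span_dirs hV he hv hx

theorem span_sub_le {V : Set E} {v w : E} (hw : w ∈ V) :
    Submodule.span ℝ ((fun y => y - w) '' V) ≤ Submodule.span ℝ ((fun y => y - v) '' V) := by
  rw [Submodule.span_le]
  rintro _ ⟨y, hy, rfl⟩
  have : y - w = (y - v) - (w - v) := by abel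
  simp only [this]
  exact Submodule.sub_mem _ (Submodule.subset_span ⟨y, hy, rfl⟩)
    (Submodule.subset_span ⟨w, hw, rfl⟩)

theorem span_dirs_eq [FiniteDimensional ℝ E] {V : Set E} (hV : V.Finite) (he : ExposedPoints V)
    {v w : E} (hv : v ∈ V) (hw : w ∈ V) :
    Submodule.span ℝ (dirs V v) = Submodule.span ℝ (dirs V w) := by
  rw [span_dirs hV he hv, span_dirs hV he hw]
  exact le_antisymm (span_sub_le hv) (span_sub_le hw)

/-- A functional that is maximal at `v` among the neighbours of `v` cuts out a face at `v`. -/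
theorem exists_face_of_forall_adj_le {V : Set E} (hV : V.Finite) (he : ExposedPoints V) {v f : E}
    (hv : v ∈ V) (h : ∀ y, Adj V v y → ⟪f, y⟫ ≤ ⟪f, v⟫) :
    ∃ F, IsFace V F ∧ v ∈ F ∧ ∀ y, Adj F v y ↔ Adj V v y ∧ ⟪f, y⟫ = ⟪f, v⟫ := by
  have hF : IsFace V {z | z ∈ V ∧ ⟪f, z⟫ = ⟪f, v⟫} :=
    ⟨f, _, le_of_forall_adj_le hV he hv h, rfl⟩
  refine ⟨_, hF, ⟨hv, rfl⟩, fun y => ⟨fun hy => ⟨hF.adj hV hy, hy.2.1.2⟩, fun hy => ?_⟩⟩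
  exact hy.1.mono hF.subset ⟨hv, rfl⟩ ⟨hy.1.2.1, hy.2⟩

/-- Vectors in an open half-space with pairwise nonpositive inner products are independent. -/
theorem linearIndependent_of_obtuse {ι : Type*} [Finite ι] {u : ι → E} (n : E)
    (hn : ∀ i, 0 < ⟪n, u i⟫) (hu : ∀ i j, i ≠ j → ⟪u i, u j⟫ ≤ 0) : LinearIndependent ℝ u := by
  classical
  have := Fintype.ofFinite ι
  rw [Fintype.linearIndependent_iff]
  intro g hg
  set p : E := ∑ i, max (g i) 0 • u i with hp
  have hq : p = ∑ i, max (-g i) 0 • u i := by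
    rw [← sub_eq_zero, hp, ← Finset.sum_sub_distrib, ← hg]
    refine Finset.sum_congr rfl fun i _ => ?_
    rw [← sub_smul]
    congr 1
    rcases le_total (g i) 0 with h | h
    · rw [max_eq_right h, max_eq_left (by linarith)]; ring
    · rw [max_eq_left h, max_eq_right (by linarith)]; ring
  have hpp : ⟪p, p⟫ ≤ 0 := by
    nth_rewrite 1 [hp]
    rw [hq, sum_inner]
    refine Finset.sum_nonpos fun i _ => ?_
    rw [inner_sum]
    refine Finset.sum_nonpos fun j _ => ?_
    rw [real_inner_smul_left, real_inner_smul_right]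
    by_cases hij : i = j
    · subst hij
      rcases le_total (g i) 0 with h | h
      · simp [max_eq_right h]
      · simp [max_eq_right (neg_nonpos.2 h)]
    · exact mul_nonpos_of_nonneg_of_nonpos (le_max_right _ _)
        (mul_nonpos_of_nonneg_of_nonpos (le_max_right _ _) (hu i j hij))
  have hp0 : p = 0 := inner_self_eq_zero.1 (le_antisymm hpp real_inner_self_nonneg)
  have key : ∀ c : ι → ℝ, (∀ i, 0 ≤ c i) → ∑ i, c i • u i = 0 → ∀ i, c i = 0 := by
    intro c hc h0 i
    have h1 : ∑ i, c i * ⟪n, u i⟫ = 0 := by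
      have := congrArg (fun z => ⟪n, z⟫) h0
      simpa [inner_sum, real_inner_smul_right] using this
    have h2 := (Finset.sum_eq_zero_iff_of_nonneg
      (fun i _ => mul_nonneg (hc i) (hn i).le)).1 h1 i (Finset.mem_univ i)
    exact (mul_eq_zero.1 h2).resolve_right (hn i).ne'
  intro i
  have h1 := key _ (fun i => le_max_right _ _) (hp ▸ hp0) i
  have h2 := key _ (fun i => le_max_right _ _) (hq ▸ hp0) i
  have h3 := max_eq_right_iff.1 h1
  have h4 := max_eq_right_iff.1 h2
  linarith

theorem exists_inner_eq [FiniteDimensional ℝ E] {ι : Type*} {u : ι → E}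
    (hu : LinearIndependent ℝ u) (c : ι → ℝ) : ∃ b : E, ∀ i, ⟪b, u i⟫ = c i := by
  obtain ⟨φ, hφ⟩ := LinearMap.exists_extend ((Module.Basis.span hu).constr ℝ c)
  refine ⟨(InnerProductSpace.toDual ℝ E).symm φ.toContinuousLinearMap, fun i => ?_⟩
  rw [InnerProductSpace.toDual_symm_apply]
  have h1 := LinearMap.congr_fun hφ (Module.Basis.span hu i)
  rw [Module.Basis.constr_basis] at h1
  simpa [Module.Basis.span_apply] using h1

end FiniteExposed

section Bipartite

variable {E : Type*} [NormedAddCommGroup E] [InnerProductSpace ℝ E]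

/-- A finite set of exposed points, split by `V1` into points of squared norm `A` and points of
squared norm `B`, such that adjacent points lie on different sides and have inner product `c`. -/
structure BipartiteConfig (V V1 : Set E) (A B c : ℝ) : Prop where
  finite : V.Finite
  exposed : ExposedPoints V
  inner_self_of_mem : ∀ x ∈ V, x ∈ V1 → ⟪x, x⟫ = A
  inner_self_of_notMem : ∀ x ∈ V, x ∉ V1 → ⟪x, x⟫ = B
  inner_of_adj : ∀ x y, Adj V x y → ⟪x, y⟫ = c
  mem_iff_of_adj : ∀ x y, Adj V x y → (x ∈ V1 ↔ y ∉ V1)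
  lt_left : c < A
  lt_right : A < B

/-- `o` is the orthogonal projection of the origin to the affine span of `F`. -/
def IsCenter (F : Set E) (o : E) : Prop :=
  ∀ x ∈ F, ⟪o, x⟫ = ⟪o, o⟫ ∧ o - x ∈ Submodule.span ℝ (dirs F x)

theorem exists_isCenter [FiniteDimensional ℝ E] {F : Set E} (hF : F.Finite) (he : ExposedPoints F)
    {x₀ : E} (hx₀ : x₀ ∈ F) : ∃ o, IsCenter F o := by
  set W := Submodule.span ℝ (dirs F x₀) with hW
  have horth : ∀ w ∈ W, ⟪x₀ - W.starProjection x₀, w⟫ = 0 := fun w hw => by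
    rw [real_inner_comm]
    exact W.inner_right_of_mem_orthogonal hw (W.sub_starProjection_mem_orthogonal x₀)
  have hmem : x₀ - W.starProjection x₀ - x₀ ∈ W := by
    rw [sub_sub_cancel_left]
    exact W.neg_mem (W.starProjection_apply_mem x₀)
  refine ⟨x₀ - W.starProjection x₀, fun x hx => ?_⟩
  have h1 : x - x₀ ∈ W := sub_mem_span_dirs hF he hx₀ hx
  have h2 : x₀ - W.starProjection x₀ - x ∈ W := by
    have := W.sub_mem hmem h1
    rwa [sub_sub_sub_cancel_right] at this
  refine ⟨?_, by rwa [span_dirs_eq hF he hx hx₀]⟩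
  have h3 := horth _ h2
  rw [inner_sub_right, sub_eq_zero] at h3
  exact h3.symm

theorem card_le_finrank_of_mem [FiniteDimensional ℝ E] {ι : Type*} [Fintype ι] {u : ι → E}
    (hu : LinearIndependent ℝ u) {W : Submodule ℝ E} (hW : ∀ i, u i ∈ W) :
    Fintype.card ι ≤ Module.finrank ℝ W := by
  have : LinearIndependent ℝ fun i => (⟨u i, hW i⟩ : W) :=
    LinearIndependent.of_comp W.subtype hu
  exact this.fintype_card_le_finrank

/-- At a vertex with independent edge directions, every set of edges spans a face. -/
theorem exists_face_of_linearIndependent [FiniteDimensional ℝ E] {V : Set E} (hV : V.Finite)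
    (he : ExposedPoints V) {x : E} (hx : x ∈ V)
    (hli : LinearIndependent ℝ fun y : {y // Adj V x y} => (y : E) - x)
    {S : Set E} (hS : ∀ y ∈ S, Adj V x y) :
    ∃ F, IsFace V F ∧ x ∈ F ∧ ∀ y, Adj F x y ↔ y ∈ S := by
  classical
  obtain ⟨b, hb⟩ := exists_inner_eq hli fun y => if (y : E) ∈ S then 0 else -1
  have hb' : ∀ y, Adj V x y → ⟪b, y⟫ = ⟪b, x⟫ + if y ∈ S then 0 else -1 := fun y hy => by
    rw [← hb ⟨y, hy⟩, inner_sub_right]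
    ring
  obtain ⟨F, hF, hxF, hadj⟩ := exists_face_of_forall_adj_le hV he (f := b) hx fun y hy => by
    rw [hb' y hy]
    split_ifs <;> linarith
  refine ⟨F, hF, hxF, fun y => ?_⟩
  rw [hadj]
  constructor
  · rintro ⟨hy, h0⟩
    rw [hb' y hy] at h0
    by_contra hyS
    rw [if_neg hyS] at h0
    linarith
  · intro hyS
    have hy := hS y hyS
    refine ⟨hy, ?_⟩
    rw [hb' y hy, if_pos hyS, add_zero]

namespace BipartiteConfig

variable {V V1 F : Set E} {A B c : ℝ}

theorem face (h : BipartiteConfig V V1 A B c) (hF : IsFace V F) : BipartiteConfig F V1 A B c where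
  finite := h.finite.subset hF.subset
  exposed := h.exposed.mono hF.subset
  inner_self_of_mem x hx := h.inner_self_of_mem x (hF.subset hx)
  inner_self_of_notMem x hx := h.inner_self_of_notMem x (hF.subset hx)
  inner_of_adj x y hxy := h.inner_of_adj x y (hF.adj h.finite hxy)
  mem_iff_of_adj x y hxy := h.mem_iff_of_adj x y (hF.adj h.finite hxy)
  lt_left := h.lt_left
  lt_right := h.lt_right

theorem lt_inner_self (h : BipartiteConfig V V1 A B c) {x : E} (hx : x ∈ V) : c < ⟪x, x⟫ := by
  by_cases hx1 : x ∈ V1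
  · rw [h.inner_self_of_mem x hx hx1]
    exact h.lt_left
  · rw [h.inner_self_of_notMem x hx hx1]
    exact h.lt_left.trans h.lt_right

theorem inner_self_lt (h : BipartiteConfig V V1 A B c) {x : E} (hx : x ∈ V) :
    ⟪x, x⟫ - c < A + B - 2 * c := by
  have h1 := h.lt_left
  have h2 := h.lt_right
  by_cases hx1 : x ∈ V1
  · rw [h.inner_self_of_mem x hx hx1]
    linarith
  · rw [h.inner_self_of_notMem x hx hx1]
    linarith

theorem inner_self_add (h : BipartiteConfig V V1 A B c) {x y : E} (hxy : Adj V x y) :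
    ⟪x, x⟫ + ⟪y, y⟫ = A + B := by
  by_cases hx : x ∈ V1
  · rw [h.inner_self_of_mem x hxy.1 hx,
      h.inner_self_of_notMem y hxy.2.1 ((h.mem_iff_of_adj x y hxy).1 hx)]
  · rw [h.inner_self_of_notMem x hxy.1 hx,
      h.inner_self_of_mem y hxy.2.1 (not_not.1 ((h.mem_iff_of_adj x y hxy).not.1 hx)), add_comm]

theorem inner_sub_self (h : BipartiteConfig V V1 A B c) {x y : E} (hxy : Adj V x y) :
    ⟪y - x, y - x⟫ = A + B - 2 * c := by
  have h1 := h.inner_self_add hxy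
  have h2 := h.inner_of_adj x y hxy
  simp only [inner_sub_left, inner_sub_right]
  rw [real_inner_comm x y] at *
  linarith

theorem inner_sub_center (h : BipartiteConfig V V1 A B c) {o x y : E} (ho : IsCenter V o)
    (hxy : Adj V x y) : ⟪y - x, o - x⟫ = ⟪x, x⟫ - c := by
  have h2 := h.inner_of_adj x y hxy
  have h3 := (ho x hxy.1).1
  have h4 := (ho y hxy.2.1).1
  simp only [inner_sub_left, inner_sub_right]
  rw [real_inner_comm o y, real_inner_comm x y, real_inner_comm o x]
  linarith

theorem inner_center_sub_self {o x : E} (ho : IsCenter V o) (hx : x ∈ V) :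
    ⟪o - x, o - x⟫ = ⟪x, x⟫ - ⟪o, o⟫ := by
  have h3 := (ho x hx).1
  simp only [inner_sub_left, inner_sub_right]
  rw [real_inner_comm o x]
  linarith

theorem inner_sub_sub_lt (h : BipartiteConfig V V1 A B c) {x y z : E} (hy : Adj V x y)
    (hz : Adj V x z) (hyz : y ≠ z) : ⟪y - x, z - x⟫ < A + B - 2 * c := by
  have h1 : 0 < ⟪(y - x) - (z - x), (y - x) - (z - x)⟫ := by
    rw [sub_sub_sub_cancel_right]
    exact real_inner_self_pos.2 (sub_ne_zero.2 hyz)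
  rw [real_inner_sub_sub_self, h.inner_sub_self hy, h.inner_sub_self hz] at h1
  linarith

/-- The geometry of a two-dimensional face at one of its corners. -/
theorem corner (h : BipartiteConfig V V1 A B c) {o x y z : E} (ho : IsCenter V o)
    (hN : ∀ w, Adj V x w ↔ w = y ∨ w = z) (hyz : y ≠ z) :
    -(A + B - 2 * c) < ⟪y - x, z - x⟫ ∧
    (⟪x, x⟫ - ⟪o, o⟫) * (A + B - 2 * c + ⟪y - x, z - x⟫) = 2 * (⟪x, x⟫ - c) ^ 2 ∧
    o - x = ((⟪x, x⟫ - ⟪o, o⟫) / (2 * (⟪x, x⟫ - c))) • ((y - x) + (z - x)) := by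
  have hy := (hN y).2 (Or.inl rfl)
  have hz := (hN z).2 (Or.inr rfl)
  have hd : dirs V x = {y - x, z - x} := by
    ext p
    simp [dirs, hN, or_and_right, exists_or, eq_comm]
  obtain ⟨a, b, hab⟩ := Submodule.mem_span_pair.1 (hd ▸ (ho x hy.1).2)
  have hK := sub_pos.2 (h.lt_inner_self hy.1)
  have e1 := h.inner_sub_center ho hy
  have e2 := h.inner_sub_center ho hz
  have e3 := inner_center_sub_self ho hy.1
  have hg := h.inner_sub_sub_lt hy hz hyz
  have e4 : ⟪o - x, o - x⟫ = (a + b) * (⟪x, x⟫ - c) := by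
    nth_rewrite 1 [← hab]
    rw [inner_add_left, real_inner_smul_left, real_inner_smul_left, e1, e2]
    ring
  rw [← hab] at e1 e2
  simp only [inner_add_right, real_inner_smul_right, h.inner_sub_self hy, h.inner_sub_self hz,
    real_inner_comm (y - x) (z - x)] at e1 e2
  set g := ⟪y - x, z - x⟫
  have hpos : 0 ≤ 2 * (A + B - 2 * c) + 2 * g := by
    have h1 : 0 ≤ ⟪(y - x) + (z - x), (y - x) + (z - x)⟫ := real_inner_self_nonneg
    rw [real_inner_add_add_self, h.inner_sub_self hy, h.inner_sub_self hz] at h1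
    linarith
  have hba : a = b := by
    have : (a - b) * (A + B - 2 * c - g) = 0 := by linarith
    rcases mul_eq_zero.1 this with h1 | h1 <;> linarith
  subst hba
  have e5 : a * (A + B - 2 * c + g) = ⟪x, x⟫ - c := by linarith
  have hne : A + B - 2 * c + g ≠ 0 := fun h0 => by
    rw [h0, mul_zero] at e5
    linarith
  rw [e4] at e3
  refine ⟨?_, ?_, ?_⟩
  · have : 0 < A + B - 2 * c + g := lt_of_le_of_ne (by linarith) hne.symm
    linarith
  · rw [← e3, ← e5]
    ring
  · rw [← e3, ← hab, ← smul_add]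
    congr 1
    field_simp
    ring

/-- The plane of a two-dimensional face is at squared distance at most `c` from the origin. -/
theorem center_le_of_two_adj [FiniteDimensional ℝ E] (h : BipartiteConfig V V1 A B c) {o x y z : E}
    (ho : IsCenter V o) (hN : ∀ w, Adj V x w ↔ w = y ∨ w = z) (hyz : y ≠ z) : ⟪o, o⟫ ≤ c := by
  classical
  by_contra! hlt
  have hy := (hN y).2 (Or.inl rfl)
  have hz := (hN z).2 (Or.inr rfl)
  have hneg : ∀ p ∈ V, ∀ q ∈ V, q ≠ p → ⟪p - o, q - o⟫ < 0 := fun p hp q hq hqp => by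
    have h1 := le_of_forall_adj_le_of_lt h.finite h.exposed (f := p) hp
      (fun w hw => (h.inner_of_adj p w hw).le) (h.lt_inner_self hp) q hq hqp
    have h2 := (ho p hp).1
    have h3 := (ho q hq).1
    simp only [inner_sub_left, inner_sub_right]
    rw [real_inner_comm o p]
    linarith
  have hg := h.inner_sub_sub_lt hy hz hyz
  have hg' := (h.corner ho hN hyz).1
  obtain ⟨x₂, hx₂, hne⟩ : ∃ x₂, Adj V y x₂ ∧ x₂ ≠ x := by
    by_contra! hcon
    have hsub : dirs V y ⊆ {x - y} := by
      rintro _ ⟨w, hw, rfl⟩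
      simp [hcon w hw]
    obtain ⟨t, ht⟩ := Submodule.mem_span_singleton.1
      (Submodule.span_mono hsub (sub_mem_span_dirs h.finite h.exposed hy.2.1 hz.2.1))
    have hw : z - x = (1 - t) • (y - x) := by
      have : z - x = (z - y) + (y - x) := by abel
      rw [this, ← ht]
      module
    have e1 := h.inner_sub_self hz
    rw [hw] at e1 hg hg'
    simp only [real_inner_smul_left, real_inner_smul_right, h.inner_sub_self hy] at e1 hg hg'
    have hL : 0 < A + B - 2 * c := by linarith [h.lt_left, h.lt_right]
    have h1 : 1 - t < 1 := by nlinarith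
    have h2 : -1 < 1 - t := by nlinarith
    nlinarith [mul_pos (sub_pos.2 h1) (sub_pos.2 h2)]
  have hx₂z : x₂ ≠ z := fun hxz => by
    subst hxz
    have h1 := h.mem_iff_of_adj _ _ hy
    have h2 := h.mem_iff_of_adj _ _ hz
    have h3 := h.mem_iff_of_adj _ _ hx₂
    tauto
  let q : Fin 3 → E := ![y, z, x₂]
  have hqV : ∀ i, q i ∈ V := by
    intro i
    fin_cases i
    exacts [hy.2.1, hz.2.1, hx₂.2.1]
  have hqx : ∀ i, q i ≠ x := by
    intro i
    fin_cases i
    exacts [hy.2.2.1.symm, hz.2.2.1.symm, hne]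
  have hqq : ∀ i j, i ≠ j → q i ≠ q j := by
    have h1 := hx₂.2.2.1
    intro i j hij
    fin_cases i <;> fin_cases j <;> simp_all [q, eq_comm]
  have hli : LinearIndependent ℝ fun i => q i - o :=
    linearIndependent_of_obtuse (-(x - o))
      (fun i => by
        rw [inner_neg_left, neg_pos]
        exact hneg x hy.1 _ (hqV i) (hqx i))
      (fun i j hij => (hneg _ (hqV i) _ (hqV j) (hqq j i hij.symm)).le)
  have hcard := card_le_finrank_of_mem hli (W := Submodule.span ℝ (dirs V x)) fun i => by
    have := Submodule.sub_mem _ (sub_mem_span_dirs h.finite h.exposed hy.1 (hqV i)) (ho x hy.1).2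
    rwa [sub_sub_sub_cancel_right] at this
  have hd : dirs V x = (({y - x, z - x} : Finset E) : Set E) := by
    ext p
    simp [dirs, hN, or_and_right, exists_or, eq_comm]
  have h2 := (finrank_span_finset_le_card (R := ℝ) ({y - x, z - x} : Finset E)).trans
    Finset.card_le_two
  rw [hd] at hcard
  simp only [Fintype.card_fin] at hcard
  unfold Set.finrank at h2
  omega

theorem inner_sub_sub_le [FiniteDimensional ℝ E] (h : BipartiteConfig V V1 A B c) {x y z : E}
    (hy : Adj V x y) (hz : Adj V x z) (hyz : y ≠ z) :
    ⟪y - x, z - x⟫ ≤ 2 * (⟪x, x⟫ - c) - (A + B - 2 * c) := by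
  have hfin : {w | Adj V x w}.Finite := h.finite.subset fun w hw => hw.2.1
  have hexp : ExposedPoints {w | Adj V x w} := fun p hp => ⟨p - x, fun q hq hqp => by
    have h1 := h.inner_sub_sub_lt hp hq hqp.symm
    have h2 := h.inner_sub_self hp
    rw [inner_sub_right] at h1 h2
    linarith⟩
  have hK := sub_pos.2 (h.lt_inner_self hy.1)
  have hadj : ∀ p, Adj {w | Adj V x w} y p →
      ⟪y - x, p - x⟫ ≤ 2 * (⟪x, x⟫ - c) - (A + B - 2 * c) := by
    rintro p ⟨-, hp, hne, a, hay, ha⟩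
    replace hp : Adj V x p := hp
    set s := (⟪a, y⟫ - ⟪a, x⟫) / (⟪x, x⟫ - c) with hs
    have hs' : s * (⟪x, x⟫ - c) = ⟪a, y⟫ - ⟪a, x⟫ := div_mul_cancel₀ _ hK.ne'
    have hval : ∀ w, Adj V x w → ⟪a + s • x, w⟫ - ⟪a + s • x, x⟫ = ⟪a, w⟫ - ⟪a, y⟫ := by
      intro w hw
      simp only [inner_add_left, real_inner_smul_left, h.inner_of_adj x w hw]
      linarith
    obtain ⟨G, hG, hxG, hGadj⟩ := exists_face_of_forall_adj_le h.finite h.exposed (f := a + s • x)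
      hy.1 fun w hw => by
        rw [← sub_nonpos, hval w hw, sub_nonpos]
        by_cases h1 : w = y
        · rw [h1]
        · by_cases h2 : w = p
          · rw [h2, hay]
          · exact (ha w hw h1 h2).le
    have hN : ∀ w, Adj G x w ↔ w = y ∨ w = p := by
      intro w
      rw [hGadj]
      constructor
      · rintro ⟨hw, hw0⟩
        rw [← sub_eq_zero, hval w hw] at hw0
        by_contra! hcon
        linarith [ha w hw hcon.1 hcon.2]
      · rintro (rfl | rfl)
        · exact ⟨hy, by rw [← sub_eq_zero, hval _ hy, sub_self]⟩
        · exact ⟨hp, by rw [← sub_eq_zero, hval _ hp, hay, sub_self]⟩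
    have h' := h.face hG
    obtain ⟨o, ho⟩ := exists_isCenter h'.finite h'.exposed hxG
    have h1 := h'.center_le_of_two_adj ho hN hne
    obtain ⟨h2, h3, -⟩ := h'.corner ho hN hne
    have h4 : (⟪x, x⟫ - c) * (A + B - 2 * c + ⟪y - x, p - x⟫) ≤
        (⟪x, x⟫ - c) * (2 * (⟪x, x⟫ - c)) := by
      nlinarith
    have := le_of_mul_le_mul_left h4 hK
    linarith
  have hlt := h.inner_self_lt hy.1
  have h1 := le_of_forall_adj_le_of_lt hfin hexp (f := y - x)
    (m := 2 * (⟪x, x⟫ - c) - (A + B - 2 * c) + ⟪y - x, x⟫) hy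
    (fun p hp => by
      have := hadj p hp
      rw [inner_sub_right] at this
      linarith)
    (by
      have := h.inner_sub_self hy
      rw [inner_sub_right] at this
      linarith) z hz hyz.symm
  rw [inner_sub_right]
  linarith

theorem linearIndependent_of_mem [FiniteDimensional ℝ E] (h : BipartiteConfig V V1 A B c) {x : E}
    (hx : x ∈ V) (hx1 : x ∈ V1) :
    LinearIndependent ℝ fun y : {y // Adj V x y} => (y : E) - x := by
  have : Finite {y // Adj V x y} := (h.finite.subset fun w (hw : Adj V x w) => hw.2.1).to_subtype
  refine linearIndependent_of_obtuse (-x) (fun y => ?_) (fun y z hyz => ?_)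
  · rw [inner_neg_left, inner_sub_right, h.inner_of_adj x y y.2, h.inner_self_of_mem x hx hx1]
    linarith [h.lt_left]
  · refine (h.inner_sub_sub_le y.2 z.2 fun h0 => hyz (Subtype.ext h0)).trans ?_
    rw [h.inner_self_of_mem x hx hx1]
    linarith [h.lt_right]

end BipartiteConfig

end Bipartite

section ThreeFaces

theorem symmetric_functions_bound {P Q p q r : ℝ} (hP : 0 < P) (hPQ : P < Q) (hp : 2 * Q ≤ p)
    (hq : 2 * Q ≤ q) (hr : 2 * Q ≤ r) (hsum : p + q + r < 4 * (P + Q)) :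
    p * q * r * (2 * Q - P) < Q ^ 2 * (4 * (p * q + p * r + q * r) - (p + q + r) ^ 2) := by
  obtain ⟨x, rfl⟩ : ∃ x, p = 2 * Q + x := ⟨p - 2 * Q, by ring⟩
  obtain ⟨y, rfl⟩ : ∃ y, q = 2 * Q + y := ⟨q - 2 * Q, by ring⟩
  obtain ⟨z, rfl⟩ : ∃ z, r = 2 * Q + z := ⟨r - 2 * Q, by ring⟩
  have hx : 0 ≤ x := by linarith
  have hy : 0 ≤ y := by linarith
  have hz : 0 ≤ z := by linarith
  have hQ : 0 < Q := by linarith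
  have h1 : 0 < Q ^ 2 * ((4 * P - 2 * Q - (x + y + z)) * (2 * Q + (x + y + z))) := by
    apply mul_pos (by positivity)
    exact mul_pos (by linarith) (by positivity)
  have h2 : 3 * (x * y * z) ≤ (2 * P) * (x * y + x * z + y * z) := by
    have h3 : 3 * (x * y * z) ≤ (x + y + z) * (x * y + x * z + y * z) := by
      have : 0 ≤ x ^ 2 * (y + z) + y ^ 2 * (x + z) + z ^ 2 * (x + y) := by positivity
      linarith
    exact h3.trans (mul_le_mul_of_nonneg_right (by linarith) (by positivity))
  have h3 : (2 * Q - P) * (x * y * z) ≤ 2 * P * Q * (x * y + x * z + y * z) := by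
    have h4 : (2 * Q - P) * (x * y * z) ≤ 2 * Q * (x * y * z) :=
      mul_le_mul_of_nonneg_right (by linarith) (by positivity)
    have h5 : 0 ≤ P * Q * (x * y + x * z + y * z) := by positivity
    nlinarith [mul_le_mul_of_nonneg_left h2 hQ.le]
  linarith

theorem sum_coords_bound {P Q g₁ g₂ g₃ s₁ s₂ s₃ : ℝ} (hP : 0 < P) (hPQ : P < Q)
    (h₁ : g₁ ≤ P - Q) (h₂ : g₂ ≤ P - Q) (h₃ : g₃ ≤ P - Q) (hsum : -(P + Q) < g₁ + g₂ + g₃)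
    (e₁ : s₁ * (P + Q) + s₂ * g₁ + s₃ * g₂ = P) (e₂ : s₁ * g₁ + s₂ * (P + Q) + s₃ * g₃ = P)
    (e₃ : s₁ * g₂ + s₂ * g₃ + s₃ * (P + Q) = P) :
    (s₁ + s₂ + s₃) * (Q - P) < 2 * Q - P := by
  obtain ⟨p, rfl⟩ : ∃ p, g₁ = P + Q - p := ⟨P + Q - g₁, by ring⟩
  obtain ⟨q, rfl⟩ : ∃ q, g₂ = P + Q - q := ⟨P + Q - g₂, by ring⟩
  obtain ⟨r, rfl⟩ : ∃ r, g₃ = P + Q - r := ⟨P + Q - g₃, by ring⟩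
  have hb := symmetric_functions_bound (p := p) (q := q) (r := r) hP hPQ (by linarith)
    (by linarith) (by linarith) (by linarith)
  set D := 4 * (p * q + p * r + q * r) - (p + q + r) ^ 2 with hD
  have hp : 0 < p := by linarith
  have hq : 0 < q := by linarith
  have hr : 0 < r := by linarith
  have hpqr : 0 < p * q * r := by positivity
  have key : (s₁ + s₂ + s₃) * ((P + Q) * D - 2 * (p * q * r)) = P * D := by
    rw [hD]
    linear_combination (-r ^ 2 + r * q + r * p) * e₁ + (r * q - q ^ 2 + p * q) * e₂
      + (r * p + p * q - p ^ 2) * e₃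
  have hD0 : 0 < D := by
    have h1 : 0 < p * q * r * (2 * Q - P) := mul_pos hpqr (by linarith)
    exact (mul_pos_iff_of_pos_left (pow_pos (hP.trans hPQ) 2)).1 (h1.trans hb)
  have hdet : 0 < (P + Q) * D - 2 * (p * q * r) := by
    have h1 : 0 < (2 * Q - P) * ((P + Q) * D - 2 * (p * q * r)) := by
      have h2 : 0 < P * (Q - P) * D := mul_pos (mul_pos hP (by linarith)) hD0
      linarith
    exact (mul_pos_iff_of_pos_left (by linarith)).1 h1
  by_contra! hcon
  have h1 := mul_le_mul_of_nonneg_right hcon hdet.le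
  have h2 : (s₁ + s₂ + s₃) * (Q - P) * ((P + Q) * D - 2 * (p * q * r)) = P * D * (Q - P) := by
    rw [← key]
    ring
  linarith

variable {E : Type*} [NormedAddCommGroup E] [InnerProductSpace ℝ E]

/-- Four independent vectors of squared norm `L` include three which are not too spread out. -/
theorem exists_three_of_linearIndependent {u : Fin 4 → E} (hu : LinearIndependent ℝ u) {L : ℝ}
    (hL : ∀ i, ⟪u i, u i⟫ = L) :
    ∃ i j k, i ≠ j ∧ i ≠ k ∧ j ≠ k ∧ -L < ⟪u i, u j⟫ + ⟪u i, u k⟫ + ⟪u j, u k⟫ := by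
  by_contra! hcon
  have h1 := hcon 0 1 2 (by decide) (by decide) (by decide)
  have h2 := hcon 0 1 3 (by decide) (by decide) (by decide)
  have h3 := hcon 0 2 3 (by decide) (by decide) (by decide)
  have h4 := hcon 1 2 3 (by decide) (by decide) (by decide)
  have hne : ∑ i, u i ≠ 0 := fun h0 => by
    have := Fintype.linearIndependent_iff.1 hu (fun _ => 1) (by simpa using h0) 0
    exact one_ne_zero this
  have hpos := real_inner_self_pos.2 hne
  simp only [Fin.sum_univ_four, inner_add_left, inner_add_right, hL, real_inner_comm (u 0),
    real_inner_comm (u 1) (u 2), real_inner_comm (u 1) (u 3), real_inner_comm (u 2) (u 3)] at *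
  linarith

theorem finrank_span_dirs [FiniteDimensional ℝ E] {V : Set E} {x : E}
    (hli : LinearIndependent ℝ fun y : {y // Adj V x y} => (y : E) - x) :
    Module.finrank ℝ (Submodule.span ℝ (dirs V x)) = {y | Adj V x y}.ncard := by
  have : Finite {y // Adj V x y} := hli.finite
  have := Fintype.ofFinite {y // Adj V x y}
  have h1 : dirs V x = range fun y : {y // Adj V x y} => (y : E) - x := by
    ext p
    simp [dirs]
  rw [h1, finrank_span_eq_card hli, ← Nat.card_coe_set_eq, coe_ofPred, Nat.card_eq_fintype_card]

namespace BipartiteConfig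

variable {V V1 F : Set E} {A B c : ℝ}

/-- A vertex in `V1` lies on a suitable three-dimensional face. -/
theorem exists_three_face [FiniteDimensional ℝ E] (h : BipartiteConfig V V1 A B c) {x : E}
    (hx : x ∈ V) (hx1 : x ∈ V1) (hdim : 4 ≤ Module.finrank ℝ (Submodule.span ℝ (dirs V x))) :
    ∃ (F : Set E) (y₁ y₂ y₃ : E), IsFace V F ∧ x ∈ F ∧ y₁ ≠ y₂ ∧ y₁ ≠ y₃ ∧ y₂ ≠ y₃ ∧
      (∀ y, Adj F x y ↔ y = y₁ ∨ y = y₂ ∨ y = y₃) ∧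
      -(A + B - 2 * c) < ⟪y₁ - x, y₂ - x⟫ + ⟪y₁ - x, y₃ - x⟫ + ⟪y₂ - x, y₃ - x⟫ := by
  have hli := h.linearIndependent_of_mem hx hx1
  have : Finite {y // Adj V x y} := hli.finite
  have := Fintype.ofFinite {y // Adj V x y}
  rw [finrank_span_dirs hli, ← Nat.card_coe_set_eq, coe_ofPred, Nat.card_eq_fintype_card] at hdim
  obtain ⟨e⟩ := Function.Embedding.nonempty_of_card_le
    (α := Fin 4) (β := {y // Adj V x y}) (by simpa using hdim)
  obtain ⟨i, j, k, hij, hik, hjk, hsum⟩ := exists_three_of_linearIndependent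
    (hli.comp e e.injective) fun i => h.inner_sub_self (e i).2
  have hne : ∀ {i j}, i ≠ j → (e i : E) ≠ e j := fun hij h0 => hij (e.injective (Subtype.ext h0))
  obtain ⟨F, hF, hxF, hadj⟩ := exists_face_of_linearIndependent h.finite h.exposed hx hli
    (S := {(e i : E), (e j : E), (e k : E)}) (by
      rintro y (rfl | rfl | rfl)
      exacts [(e i).2, (e j).2, (e k).2])
  exact ⟨F, e i, e j, e k, hF, hxF, hne hij, hne hik, hne hjk, hadj, hsum⟩

theorem center_bound (h : BipartiteConfig F V1 A B c) {o x y₁ y₂ y₃ : E}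
    (ho : IsCenter F o) (hx : x ∈ F) (hx1 : x ∈ V1)
    (hg : ∀ y z, Adj F x y → Adj F x z → y ≠ z → ⟪y - x, z - x⟫ ≤ A - B)
    (h₁₂ : y₁ ≠ y₂) (h₁₃ : y₁ ≠ y₃) (h₂₃ : y₂ ≠ y₃)
    (hN : ∀ y, Adj F x y ↔ y = y₁ ∨ y = y₂ ∨ y = y₃)
    (hsum : -(A + B - 2 * c) < ⟪y₁ - x, y₂ - x⟫ + ⟪y₁ - x, y₃ - x⟫ + ⟪y₂ - x, y₃ - x⟫) :
    (B - A) * (B - ⟪o, o⟫) < (B - c) ^ 2 := by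
  have hy₁ := (hN y₁).2 (by simp)
  have hy₂ := (hN y₂).2 (by simp)
  have hy₃ := (hN y₃).2 (by simp)
  have hd : dirs F x = {y₁ - x, y₂ - x, y₃ - x} := by
    ext p
    simp [dirs, hN, or_and_right, exists_or, eq_comm]
  obtain ⟨s₁, s₂, s₃, hs⟩ := Submodule.mem_span_triple.1 (hd ▸ (ho x hx).2)
  have hxx := h.inner_self_of_mem x hx hx1
  have e₁ := h.inner_sub_center ho hy₁
  have e₂ := h.inner_sub_center ho hy₂
  have e₃ := h.inner_sub_center ho hy₃
  have e₄ : ⟪o - x, o - x⟫ = (s₁ + s₂ + s₃) * (A - c) := by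
    nth_rewrite 1 [← hs]
    simp only [inner_add_left, real_inner_smul_left, e₁, e₂, e₃, hxx]
    ring
  rw [inner_center_sub_self ho hx, hxx] at e₄
  rw [← hs, hxx] at e₁ e₂ e₃
  simp only [inner_add_right, real_inner_smul_right, h.inner_sub_self hy₁, h.inner_sub_self hy₂,
    h.inner_sub_self hy₃, real_inner_comm (y₁ - x) (y₂ - x), real_inner_comm (y₁ - x) (y₃ - x),
    real_inner_comm (y₂ - x) (y₃ - x)] at e₁ e₂ e₃
  have hA := h.lt_left
  have hB := h.lt_right
  have hb := sum_coords_bound (P := A - c) (Q := B - c) (s₁ := s₁) (s₂ := s₂) (s₃ := s₃)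
    (g₁ := ⟪y₁ - x, y₂ - x⟫) (g₂ := ⟪y₁ - x, y₃ - x⟫) (g₃ := ⟪y₂ - x, y₃ - x⟫)
    (by linarith) (by linarith)
    (by linarith [hg _ _ hy₁ hy₂ h₁₂]) (by linarith [hg _ _ hy₁ hy₃ h₁₃])
    (by linarith [hg _ _ hy₂ hy₃ h₂₃]) (by linarith) (by linarith) (by linarith) (by linarith)
  have := mul_lt_mul_of_pos_right hb (sub_pos.2 hA)
  nlinarith

theorem linearIndependent_of_notMem [FiniteDimensional ℝ E] (h : BipartiteConfig F V1 A B c)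
    {o x : E} (ho : IsCenter F o) (hx : x ∈ F) (hx1 : x ∉ V1)
    (hlt : (B - A) * (B - ⟪o, o⟫) < (B - c) ^ 2) :
    LinearIndependent ℝ fun y : {y // Adj F x y} => (y : E) - x := by
  have : Finite {y // Adj F x y} := (h.finite.subset fun w (hw : Adj F x w) => hw.2.1).to_subtype
  have := Fintype.ofFinite {y // Adj F x y}
  have hxx := h.inner_self_of_notMem x hx hx1
  have hQ : 0 < B - c := by linarith [h.lt_left, h.lt_right]
  obtain ⟨t, ht⟩ : ∃ t, t * (B - c) = B - A := ⟨(B - A) / (B - c), div_mul_cancel₀ _ hQ.ne'⟩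
  have ht0 : 0 < t := pos_of_mul_pos_left (by rw [ht]; linarith [h.lt_right]) hQ.le
  have hM : ⟪o - x, o - x⟫ = B - ⟪o, o⟫ := by rw [inner_center_sub_self ho hx, hxx]
  have htM : t * (B - ⟪o, o⟫) < B - c := by
    rw [← ht] at hlt
    nlinarith
  have hu : LinearIndependent ℝ fun y : {y // Adj F x y} => ((y : E) - x) - t • (o - x) := by
    refine linearIndependent_of_obtuse (o - x) (fun y => ?_) (fun y z hyz => ?_)
    · have h1 := h.inner_sub_center ho y.2
      rw [inner_sub_right, real_inner_smul_right, real_inner_comm, h1, hxx, hM]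
      linarith
    · have h1 := h.inner_sub_center ho y.2
      have h2 := h.inner_sub_center ho z.2
      have h3 := h.inner_sub_sub_le y.2 z.2 fun h0 => hyz (Subtype.ext h0)
      simp only [inner_sub_left _ (t • (o - x)), inner_sub_right _ _ (t • (o - x)),
        real_inner_smul_left, real_inner_smul_right]
      rw [real_inner_comm ((z : E) - x) (o - x), h1, h2, hM]
      rw [hxx] at h3 ⊢
      nlinarith
  have hd : dirs F x = range fun y : {y // Adj F x y} => (y : E) - x := by
    ext p
    simp [dirs]
  rw [linearIndependent_iff_card_le_finrank_span]
  refine card_le_finrank_of_mem hu fun y => ?_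
  rw [← hd]
  exact Submodule.sub_mem _ (Submodule.subset_span ⟨y, y.2, rfl⟩)
    (Submodule.smul_mem _ _ (ho x hx).2)

end BipartiteConfig

end ThreeFaces

section SimpleThreeFaces

theorem three_corners_bound {P Q m₁ m₂ m₃ : ℝ} (hP : 0 < P) (hPQ : P < Q) (h₁ : P ≤ m₁)
    (h₂ : P ≤ m₂) (h₃ : P ≤ m₃) :
    (m₃ + (Q - P)) * (m₁ * m₂ / m₃ + (P + Q) *
      ((m₁ + (Q - P)) * (m₂ + (Q - P)) / Q ^ 2 - m₁ * m₂ / P ^ 2))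
      < (m₁ + (Q - P)) * (m₂ + (Q - P)) := by
  have hQ : 0 < Q := hP.trans hPQ
  obtain ⟨a, ha, rfl⟩ : ∃ a, 0 ≤ a ∧ m₁ = P * (1 + a) :=
    ⟨m₁ / P - 1, by rw [sub_nonneg, one_le_div hP]; exact h₁, by field_simp; ring⟩
  obtain ⟨b, hb, rfl⟩ : ∃ b, 0 ≤ b ∧ m₂ = P * (1 + b) :=
    ⟨m₂ / P - 1, by rw [sub_nonneg, one_le_div hP]; exact h₂, by field_simp; ring⟩
  have hm₃ : 0 < m₃ := by linarith
  obtain ⟨t, ht0, ht1, ht⟩ : ∃ t, 0 ≤ t ∧ t ≤ 1 ∧ m₃ * t = P :=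
    ⟨P / m₃, by positivity, by rw [div_le_one hm₃]; exact h₃, by field_simp⟩
  have e₁ : P * (1 + a) * (P * (1 + b)) / m₃ = t * P * (1 + a) * (1 + b) := by
    rw [div_eq_iff hm₃.ne']
    linear_combination (-P * (1 + a) * (1 + b)) * ht
  have e₂ : (P + Q) * ((P * (1 + a) + (Q - P)) * (P * (1 + b) + (Q - P)) / Q ^ 2
      - P * (1 + a) * (P * (1 + b)) / P ^ 2)
      = -((Q - P) * ((P + Q) / Q) * ((P * (a * b) + Q * (a + b + a * b)) / Q)) := by
    field_simp
    ring
  have h₄ : P * (a * b) ≤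
      (m₃ + (Q - P)) * ((P + Q) / Q) * ((P * (a * b) + Q * (a + b + a * b)) / Q) := by
    have h5 : 1 ≤ (m₃ + (Q - P)) / Q := by rw [one_le_div hQ]; linarith
    have h6 : 1 ≤ (P + Q) / Q := by rw [one_le_div hQ]; linarith
    have h7 : P * (a * b) ≤ P * (a * b) + Q * (a + b + a * b) := by
      have : 0 ≤ Q * (a + b + a * b) := by positivity
      linarith
    have h8 : 0 ≤ P * (a * b) + Q * (a + b + a * b) := by positivity
    calc P * (a * b) ≤ 1 * 1 * (P * (a * b) + Q * (a + b + a * b)) := by linarith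
      _ ≤ (m₃ + (Q - P)) / Q * ((P + Q) / Q) * (P * (a * b) + Q * (a + b + a * b)) := by gcongr
      _ = _ := by ring
  have h₅ : (m₃ + (Q - P)) * (t * P * (1 + a) * (1 + b))
      ≤ P ^ 2 * (1 + a) * (1 + b) + (Q - P) * (P * (1 + a) * (1 + b)) := by
    have h6 : (m₃ + (Q - P)) * (t * P * (1 + a) * (1 + b))
        = P ^ 2 * (1 + a) * (1 + b) + t * ((Q - P) * (P * (1 + a) * (1 + b))) := by
      linear_combination (P * (1 + a) * (1 + b)) * ht
    have h7 : 0 ≤ (Q - P) * (P * (1 + a) * (1 + b)) :=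
      mul_nonneg (by linarith) (by positivity)
    nlinarith
  rw [e₁, e₂]
  have h₆ := mul_le_mul_of_nonneg_left h₄ (sub_pos.2 hPQ).le
  have h₇ := mul_pos (sub_pos.2 hPQ) hQ
  linarith

theorem length_mul_lt {P Q m₁ m₂ m₃ g₁ g₂ g₃ s₁ s₂ k₁ k₂ : ℝ} (hP : 0 < P) (hPQ : P < Q)
    (h₁ : P ≤ m₁) (h₂ : P ≤ m₂) (h₃ : P ≤ m₃) (e₁ : m₁ * (P + Q + g₁) = 2 * P ^ 2)
    (e₂ : m₂ * (P + Q + g₂) = 2 * P ^ 2) (e₃ : m₃ * (P + Q + g₃) = 2 * P ^ 2)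
    (hs₁ : s₁ = Q * m₁ / (P * (m₁ + (Q - P)))) (hs₂ : s₂ = Q * m₂ / (P * (m₂ + (Q - P))))
    (hk₁ : k₁ = 1 + s₁ - 2 * Q / (m₁ + (Q - P))) (hk₂ : k₂ = 1 + s₂ - 2 * Q / (m₂ + (Q - P))) :
    (m₃ + (Q - P)) * (P + Q + (s₁ * s₂ * g₃ + s₁ * k₂ * g₁ + k₁ * s₂ * g₂ + k₁ * k₂ * (P + Q)))
      < 2 * Q ^ 2 := by
  have hb := three_corners_bound hP hPQ h₁ h₂ h₃
  have hQ : 0 < Q := hP.trans hPQ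
  have hm₁ : 0 < m₁ := by linarith
  have hm₂ : 0 < m₂ := by linarith
  have hm₃ : 0 < m₃ := by linarith
  have hn₁ : 0 < m₁ + (Q - P) := by linarith
  have hn₂ : 0 < m₂ + (Q - P) := by linarith
  have hg₁ : g₁ = 2 * P ^ 2 / m₁ - (P + Q) := by field_simp; linarith
  have hg₂ : g₂ = 2 * P ^ 2 / m₂ - (P + Q) := by field_simp; linarith
  have hg₃ : g₃ = 2 * P ^ 2 / m₃ - (P + Q) := by field_simp; linarith
  have key : P + Q + (s₁ * s₂ * g₃ + s₁ * k₂ * g₁ + k₁ * s₂ * g₂ + k₁ * k₂ * (P + Q))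
      = 2 * Q ^ 2 / ((m₁ + (Q - P)) * (m₂ + (Q - P))) * (m₁ * m₂ / m₃ + (P + Q) *
        ((m₁ + (Q - P)) * (m₂ + (Q - P)) / Q ^ 2 - m₁ * m₂ / P ^ 2)) := by
    rw [hk₁, hk₂, hs₁, hs₂, hg₁, hg₂, hg₃]
    field_simp
    ring
  rw [key, mul_left_comm, div_mul_eq_mul_div, div_lt_iff₀ (mul_pos hn₁ hn₂)]
  exact mul_lt_mul_of_pos_left hb (by positivity)

variable {E : Type*} [NormedAddCommGroup E] [InnerProductSpace ℝ E]

/-- The edge directions at every vertex are independent. -/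
def IsSimple (V : Set E) : Prop :=
  ∀ x ∈ V, LinearIndependent ℝ fun y : {y // Adj V x y} => (y : E) - x

theorem IsSimple.face {V F : Set E} (hs : IsSimple V) (hV : V.Finite) (hF : IsFace V F) :
    IsSimple F := fun x hx =>
  (hs x (hF.subset hx)).comp (fun y : {y // Adj F x y} => (⟨y, hF.adj hV y.2⟩ : {y // Adj V x y}))
    fun _ _ hyz => Subtype.ext (Subtype.mk.inj hyz)

variable [FiniteDimensional ℝ E]

theorem IsSimple.ncard_eq {V : Set E} (hs : IsSimple V) (hV : V.Finite) (he : ExposedPoints V)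
    {x y : E} (hx : x ∈ V) (hy : y ∈ V) : {z | Adj V x z}.ncard = {z | Adj V y z}.ncard := by
  rw [← finrank_span_dirs (hs x hx), ← finrank_span_dirs (hs y hy), span_dirs_eq hV he hx hy]

/-- Two edges at a vertex of a simple polytope span a two-dimensional face. -/
theorem IsSimple.exists_two_face {V : Set E} (hs : IsSimple V) (hV : V.Finite)
    (he : ExposedPoints V) {x y z : E} (hy : Adj V x y) (hz : Adj V x z) (hyz : y ≠ z) :
    ∃ G, IsFace V G ∧ x ∈ G ∧ (∀ w, Adj G x w ↔ w = y ∨ w = z) ∧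
      ∀ p q, Adj G p q → ∃ r, r ≠ q ∧ ∀ w, Adj G p w ↔ w = q ∨ w = r := by
  obtain ⟨G, hG, hxG, hadj⟩ := exists_face_of_linearIndependent hV he hy.1 (hs x hy.1)
    (S := {y, z}) (by
      rintro w (rfl | rfl)
      exacts [hy, hz])
  refine ⟨G, hG, hxG, hadj, fun p q hpq => ?_⟩
  have h1 := (hs.face hV hG).ncard_eq (hV.subset hG.subset) (he.mono hG.subset) hpq.1 hxG
  have h2 : {w | Adj G x w} = {y, z} := Set.ext hadj
  rw [h2, ncard_pair hyz] at h1
  obtain ⟨r, s, hrs, h3⟩ := ncard_eq_two.1 h1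
  have h4 : ∀ w, Adj G p w ↔ w = r ∨ w = s := fun w => Set.ext_iff.1 h3 w
  rcases (h4 q).1 hpq with rfl | rfl
  · exact ⟨s, hrs.symm, h4⟩
  · exact ⟨r, hrs, fun w => (h4 w).trans or_comm⟩

namespace BipartiteConfig

variable {V V1 : Set E} {A B c : ℝ}

theorem exists_simple_face (h : BipartiteConfig V V1 A B c) {x : E}
    (hx : x ∈ V) (hx1 : x ∈ V1) (hdim : 4 ≤ Module.finrank ℝ (Submodule.span ℝ (dirs V x))) :
    ∃ F, BipartiteConfig F V1 A B c ∧ IsSimple F ∧ x ∈ F ∧ {y | Adj F x y}.ncard = 3 := by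
  obtain ⟨F, y₁, y₂, y₃, hF, hxF, h₁₂, h₁₃, h₂₃, hN, hsum⟩ := h.exists_three_face hx hx1 hdim
  have hB := h.face hF
  obtain ⟨o, ho⟩ := exists_isCenter hB.finite hB.exposed hxF
  have hlt := hB.center_bound ho hxF hx1 (fun y z hy hz hyz => by
    have := hB.inner_sub_sub_le hy hz hyz
    rw [hB.inner_self_of_mem x hxF hx1] at this
    linarith) h₁₂ h₁₃ h₂₃ hN hsum
  refine ⟨F, hB, fun p hp => ?_, hxF, ?_⟩
  · by_cases hp1 : p ∈ V1
    · exact hB.linearIndependent_of_mem hp hp1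
    · exact hB.linearIndependent_of_notMem ho hp hp1 hlt
  · exact ncard_eq_three.2 ⟨y₁, y₂, y₃, h₁₂, h₁₃, h₂₃, Set.ext hN⟩

/-- The two corners of a two-dimensional face at the ends of an edge determine each other. -/
theorem two_corners {G : Set E} (h : BipartiteConfig G V1 A B c) {v w a y : E} (hv1 : v ∈ V1)
    (hv : ∀ p, Adj G v p ↔ p = a ∨ p = w) (haw : a ≠ w) (hw : ∀ p, Adj G w p ↔ p = v ∨ p = y)
    (hvy : v ≠ y) :
    ∃ m s k : ℝ, A - c ≤ m ∧ m * (A - c + (B - c) + ⟪a - v, w - v⟫) = 2 * (A - c) ^ 2 ∧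
      s = (B - c) * m / ((A - c) * (m + (B - c - (A - c)))) ∧
      k = 1 + s - 2 * (B - c) / (m + (B - c - (A - c))) ∧
      y - w = s • (a - v) + k • (w - v) := by
  have hvw := (hv w).2 (Or.inr rfl)
  obtain ⟨o, ho⟩ := exists_isCenter h.finite h.exposed hvw.1
  have hle := h.center_le_of_two_adj ho hv haw
  obtain ⟨-, h1, h2⟩ := h.corner ho hv haw
  obtain ⟨-, -, h3⟩ := h.corner ho hw hvy
  rw [h.inner_self_of_mem v hvw.1 hv1] at h1 h2
  rw [h.inner_self_of_notMem w hvw.2.1 ((h.mem_iff_of_adj v w hvw).1 hv1)] at h3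
  have hA := h.lt_left
  have hB := h.lt_right
  have hn : A - ⟪o, o⟫ + (B - c - (A - c)) = B - ⟪o, o⟫ := by ring
  refine ⟨A - ⟪o, o⟫, _, _, by linarith, by rw [← h1]; ring, rfl, rfl, ?_⟩
  rw [hn]
  set n := B - ⟪o, o⟫
  set m := A - ⟪o, o⟫
  have hP : A - c ≠ 0 := by linarith
  have hQ : B - c ≠ 0 := by linarith
  have hn0 : n ≠ 0 := by
    have : 0 < n := by linarith
    exact this.ne'
  have e1 : y - w = (2 * (B - c) / n) • ((o - v) - (w - v)) + (w - v) := by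
    rw [sub_sub_sub_cancel_right, h3, smul_smul, div_mul_div_cancel₀ hn0,
      div_self (mul_ne_zero two_ne_zero hQ), one_smul]
    abel
  rw [e1, h2]
  match_scalars <;> field_simp <;> ring

theorem false_of_isSimple {F : Set E} (h : BipartiteConfig F V1 A B c) (hs : IsSimple F) {x : E}
    (hx : x ∈ F) (hx1 : x ∈ V1) (hcard : {y | Adj F x y}.ncard = 3) : False := by
  obtain ⟨⟨v, a, b⟩, ⟨hv1, ha, hb, hab⟩, hmin⟩ := exists_min_image
    {t : E × E × E | t.1 ∈ V1 ∧ Adj F t.1 t.2.1 ∧ Adj F t.1 t.2.2 ∧ t.2.1 ≠ t.2.2}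
    (fun t => ⟪t.2.1 - t.1, t.2.2 - t.1⟫)
    ((h.finite.prod (h.finite.prod h.finite)).subset fun t ht =>
      ⟨ht.2.1.1, ht.2.1.2.1, ht.2.2.1.2.1⟩)
    (by
      obtain ⟨a, b, w, hab, -, -, hN⟩ := ncard_eq_three.1 hcard
      exact ⟨(x, a, b), hx1, (Set.ext_iff.1 hN a).2 (by simp),
        (Set.ext_iff.1 hN b).2 (by simp), hab⟩)
  dsimp only at hv1 ha hb hab hmin
  obtain ⟨w, hw, hwa, hwb⟩ : ∃ w, Adj F v w ∧ w ≠ a ∧ w ≠ b := by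
    by_contra! hcon
    have h1 := hs.ncard_eq h.finite h.exposed hx ha.1
    have h2 : {y | Adj F v y} ⊆ {a, b} := fun y hy => by
      by_cases hya : y = a
      exacts [Or.inl hya, Or.inr (hcon y hy hya)]
    have h3 := ncard_le_ncard h2
    rw [ncard_pair hab] at h3
    omega
  obtain ⟨G₁, hG₁, -, hv₁, hc₁⟩ := hs.exists_two_face h.finite h.exposed ha hw hwa.symm
  obtain ⟨G₂, hG₂, -, hv₂, hc₂⟩ := hs.exists_two_face h.finite h.exposed hb hw hwb.symm
  obtain ⟨y₁, hy₁v, hw₁⟩ := hc₁ w v ((hv₁ w).2 (Or.inr rfl)).symm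
  obtain ⟨y₂, hy₂v, hw₂⟩ := hc₂ w v ((hv₂ w).2 (Or.inr rfl)).symm
  obtain ⟨m₁, s₁, k₁, hm₁, e₁, hs₁, hk₁, hy₁⟩ :=
    (h.face hG₁).two_corners hv1 hv₁ hwa.symm hw₁ hy₁v.symm
  obtain ⟨m₂, s₂, k₂, hm₂, e₂, hs₂, hk₂, hy₂⟩ :=
    (h.face hG₂).two_corners hv1 hv₂ hwb.symm hw₂ hy₂v.symm
  have hA := h.lt_left
  have hB := h.lt_right
  have hy : y₁ ≠ y₂ := fun hy => by
    have hli := (hs v ha.1).comp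
      (![⟨a, ha⟩, ⟨b, hb⟩, ⟨w, hw⟩] : Fin 3 → {y // Adj F v y}) (by
        intro i j hij
        fin_cases i <;> fin_cases j <;> simp_all [Subtype.ext_iff, eq_comm])
    have h0 := Fintype.linearIndependent_iff.1 hli ![s₁, -s₂, k₁ - k₂] (by
      rw [hy, hy₂, ← sub_eq_zero] at hy₁
      simp only [Fin.sum_univ_three, Function.comp_apply, Matrix.cons_val_zero,
        Matrix.cons_val_one, Matrix.cons_val]
      rw [← neg_eq_zero, ← hy₁]
      module) 0
    have h1 : s₁ = 0 := h0
    have h2 : 0 < s₁ := by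
      rw [hs₁]
      exact div_pos (mul_pos (by linarith) (by linarith)) (mul_pos (by linarith) (by linarith))
    exact h2.ne' h1
  have hwy₁ : Adj F w y₁ := hG₁.adj h.finite ((hw₁ y₁).2 (Or.inr rfl))
  have hwy₂ : Adj F w y₂ := hG₂.adj h.finite ((hw₂ y₂).2 (Or.inr rfl))
  obtain ⟨G₃, hG₃, hwG₃, hw₃, hc₃⟩ := hs.exists_two_face h.finite h.exposed hwy₁ hwy₂ hy
  obtain ⟨t, htw, ht⟩ := hc₃ y₁ w ((hw₃ y₁).2 (Or.inl rfl)).symm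
  obtain ⟨G₀, hG₀, hvG₀, hv₀, -⟩ := hs.exists_two_face h.finite h.exposed ha hb hab
  have hw1 : w ∉ V1 := (h.mem_iff_of_adj v w hw).1 hv1
  have hy₁1 : y₁ ∈ V1 := not_not.1 ((h.mem_iff_of_adj w y₁ hwy₁).not.1 hw1)
  have h₃ := h.face hG₃
  have h₀ := h.face hG₀
  obtain ⟨o₃, ho₃⟩ := exists_isCenter h₃.finite h₃.exposed hwG₃
  obtain ⟨o₀, ho₀⟩ := exists_isCenter h₀.finite h₀.exposed hvG₀
  have hle₀ := h₀.center_le_of_two_adj ho₀ hv₀ hab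
  have hle₃ := h₃.center_le_of_two_adj ho₃ hw₃ hy
  obtain ⟨f₀, f₁, -⟩ := h₀.corner ho₀ hv₀ hab
  obtain ⟨f₂, f₃, -⟩ := h₃.corner ho₃ hw₃ hy
  obtain ⟨-, f₄, -⟩ := h₃.corner ho₃ ht htw.symm
  have hmin' := hmin (y₁, w, t)
    ⟨hy₁1, hwy₁.symm, hG₃.adj h.finite ((ht t).2 (Or.inr rfl)), htw.symm⟩
  rw [h.inner_self_of_mem v ha.1 hv1] at f₁
  rw [h.inner_self_of_notMem w hw.2.1 hw1] at f₃
  rw [h.inner_self_of_mem y₁ hwy₁.2.1 hy₁1] at f₄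
  have hm : A - ⟪o₃, o₃⟫ ≤ A - ⟪o₀, o₀⟫ := by
    refine le_of_mul_le_mul_right (a := A + B - 2 * c + ⟪a - v, b - v⟫) ?_ (by linarith)
    rw [f₁, ← f₄]
    exact mul_le_mul_of_nonneg_left (by linarith) (by linarith)
  have hlt := length_mul_lt (P := A - c) (Q := B - c) (m₃ := A - ⟪o₀, o₀⟫)
    (g₃ := ⟪a - v, b - v⟫) (by linarith) (by linarith) hm₁ hm₂ (by linarith) e₁ e₂
    (by rw [← f₁]; ring) hs₁ hs₂ hk₁ hk₂
  have hG : ⟪y₁ - w, y₂ - w⟫ = s₁ * s₂ * ⟪a - v, b - v⟫ + s₁ * k₂ * ⟪a - v, w - v⟫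
      + k₁ * s₂ * ⟪b - v, w - v⟫ + k₁ * k₂ * (A - c + (B - c)) := by
    rw [hy₁, hy₂]
    simp only [inner_add_left, inner_add_right, real_inner_smul_left, real_inner_smul_right,
      h.inner_sub_self hw, real_inner_comm (b - v) (w - v)]
    ring
  rw [← hG] at hlt
  have hfin := mul_le_mul_of_nonneg_right (show B - ⟪o₃, o₃⟫ ≤ A - ⟪o₀, o₀⟫ + (B - c - (A - c)) by
    linarith) (show 0 ≤ A - c + (B - c) + ⟪y₁ - w, y₂ - w⟫ by linarith)
  linarith

theorem finrank_lt_four (h : BipartiteConfig V V1 A B c) {x : E} (hx : x ∈ V) (hx1 : x ∈ V1) :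
    Module.finrank ℝ (Submodule.span ℝ (dirs V x)) < 4 := by
  by_contra! hdim
  obtain ⟨F, hF, hs, hxF, hcard⟩ := h.exists_simple_face hx hx1 hdim
  exact hF.false_of_isSimple hs hxF hx1 hcard

end BipartiteConfig

end SimpleThreeFaces

section Polytopes

variable {E : Type*} [NormedAddCommGroup E] [InnerProductSpace ℝ E]

theorem BipartiteConfig.lt_of_one_lt_finrank {V V1 : Set E} {A c : ℝ} (hV : V.Finite)
    (he : ExposedPoints V) (hA : ∀ x ∈ V, x ∈ V1 → ⟪x, x⟫ = A)
    (hadj : ∀ x y, Adj V x y → ⟪x, y⟫ = c) (hbip : ∀ x y, Adj V x y → (x ∈ V1 ↔ y ∉ V1))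
    {v w : E} (hvw : Adj V v w) (hv1 : v ∈ V1)
    (hdim : 1 < Module.finrank ℝ (Submodule.span ℝ (dirs V w))) : c < A := by
  by_contra! hcon
  have hge := le_of_forall_adj_le hV he (f := -v) hvw.1 fun y hy => by
    rw [inner_neg_left, inner_neg_left, hadj v y hy, hA v hvw.1 hv1]
    linarith
  have huniq : ∀ x ∈ V, x ∈ V1 → x = v := fun x hx hx1 => by
    have h1 := hge x hx
    rw [inner_neg_left, inner_neg_left, hA v hvw.1 hv1] at h1
    rw [← sub_eq_zero, ← inner_self_eq_zero (𝕜 := ℝ)]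
    refine le_antisymm ?_ real_inner_self_nonneg
    rw [real_inner_sub_sub_self, hA v hvw.1 hv1, hA x hx hx1, real_inner_comm]
    linarith
  have hd : dirs V w ⊆ {v - w} := by
    rintro _ ⟨y, hy, rfl⟩
    have h1 := hbip v w hvw
    have h2 := hbip w y hy
    simp [huniq y hy.2.1 (by tauto)]
  have h3 := Submodule.finrank_mono (Submodule.span_mono (R := ℝ) hd)
  have h4 := finrank_span_le_card (R := ℝ) ({v - w} : Set E)
  simp only [toFinset_singleton, Finset.card_singleton] at h4
  omega

theorem finite_extremePoints_convexHull {S : Set E} (hS : S.Finite) :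
    (extremePoints ℝ (convexHull ℝ S)).Finite :=
  hS.subset extremePoints_convexHull_subset

theorem convexHull_extremePoints_convexHull {S : Set E} (hS : S.Finite) :
    convexHull ℝ (extremePoints ℝ (convexHull ℝ S)) = convexHull ℝ S := by
  have h1 := closure_convexHull_extremePoints (hS.isCompact_convexHull ℝ) (convex_convexHull ℝ S)
  rwa [((finite_extremePoints_convexHull hS).isClosed_convexHull ℝ).closure_eq] at h1

theorem exposedPoints_extremePoints [CompleteSpace E] {S : Set E} (hS : S.Finite) :
    ExposedPoints (extremePoints ℝ (convexHull ℝ S)) := by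
  intro x hx
  have hfin := finite_extremePoints_convexHull hS
  have hconv := (((convex_convexHull ℝ S).mem_extremePoints_iff_convex_sdiff).1 hx).2
  have hsub : convexHull ℝ (extremePoints ℝ (convexHull ℝ S) \ {x}) ⊆ convexHull ℝ S \ {x} :=
    convexHull_min (sdiff_subset_sdiff_left extremePoints_subset) hconv
  obtain ⟨f, u, hf, hu⟩ := geometric_hahn_banach_closed_point (convex_convexHull ℝ _)
    ((hfin.subset sdiff_subset).isClosed_convexHull ℝ) (fun hmem => (hsub hmem).2 rfl :
      x ∉ convexHull ℝ (extremePoints ℝ (convexHull ℝ S) \ {x}))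
  refine ⟨(InnerProductSpace.toDual ℝ E).symm f, fun y hy hyx => ?_⟩
  rw [InnerProductSpace.toDual_symm_apply, InnerProductSpace.toDual_symm_apply]
  exact (hf y (subset_convexHull ℝ _ ⟨hy, hyx⟩)).trans hu

theorem Adj.isExposed {V : Set E} {x y : E} (h : Adj V x y) :
    IsExposed ℝ (convexHull ℝ V) (segment ℝ x y) := by
  obtain ⟨hx, hy, -, a, hay, ha⟩ := h
  intro _
  have hseg : ∀ p ∈ segment ℝ x y, ⟪a, p⟫ = ⟪a, x⟫ := by
    rintro _ ⟨s, t, -, -, hst, rfl⟩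
    rw [inner_add_right, real_inner_smul_right, real_inner_smul_right, ← hay, ← add_mul, hst,
      one_mul]
  have hconv : Convex ℝ ({p | ⟪a, p⟫ < ⟪a, x⟫} ∪ segment ℝ x y) := by
    rw [convex_iff_forall_pos]
    intro p hp q hq s t hs ht hst
    have hle : ∀ r ∈ ({p | ⟪a, p⟫ < ⟪a, x⟫} ∪ segment ℝ x y), ⟪a, r⟫ ≤ ⟪a, x⟫ := by
      rintro r (hr | hr)
      exacts [le_of_lt hr, (hseg r hr).le]
    have hval : ⟪a, s • p + t • q⟫ = s * ⟪a, p⟫ + t * ⟪a, q⟫ := by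
      rw [inner_add_right, real_inner_smul_right, real_inner_smul_right]
    have hsum : s * ⟪a, x⟫ + t * ⟪a, x⟫ = ⟪a, x⟫ := by rw [← add_mul, hst, one_mul]
    rcases hp with hp' | hp'
    · left
      have h1 := mul_lt_mul_of_pos_left hp' hs
      have h2 := mul_le_mul_of_nonneg_left (hle q hq) ht.le
      simp only [mem_ofPred_eq, hval]
      linarith
    · rcases hq with hq' | hq'
      · left
        have h1 := mul_lt_mul_of_pos_left hq' ht
        have h2 := mul_le_mul_of_nonneg_left (hseg p hp').le hs.le
        simp only [mem_ofPred_eq, hval]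
        linarith
      · exact Or.inr (convex_segment x y hp' hq' hs.le ht.le hst)
  have hsub : convexHull ℝ V ⊆ {p | ⟪a, p⟫ < ⟪a, x⟫} ∪ segment ℝ x y := by
    refine convexHull_min (fun z hz => ?_) hconv
    by_cases hzx : z = x
    · exact Or.inr (hzx ▸ left_mem_segment ℝ x y)
    · by_cases hzy : z = y
      · exact Or.inr (hzy ▸ right_mem_segment ℝ x y)
      · exact Or.inl (ha z hz hzx hzy)
  refine ⟨innerSL ℝ a, Set.ext fun p => ⟨fun hp => ⟨?_, fun q hq => ?_⟩, fun hp => ?_⟩⟩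
  · exact (convex_convexHull ℝ V).segment_subset (subset_convexHull ℝ V hx)
      (subset_convexHull ℝ V hy) hp
  · simp only [innerSL_apply_apply]
    rw [hseg p hp]
    rcases hsub hq with h1 | h1
    exacts [le_of_lt h1, (hseg q h1).le]
  · refine (hsub hp.1).resolve_left fun h1 => ?_
    have h2 := hp.2 x (subset_convexHull ℝ V hx)
    exact absurd h1 (not_lt.2 h2)

theorem span_dirs_eq_top [FiniteDimensional ℝ E] {V : Set E} (hV : V.Finite)
    (he : ExposedPoints V) (hspan : affineSpan ℝ (convexHull ℝ V) = ⊤) {x : E} (hx : x ∈ V) :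
    Submodule.span ℝ (dirs V x) = ⊤ := by
  rw [affineSpan_convexHull] at hspan
  have h1 := vectorSpan_eq_span_vsub_set_right ℝ hx
  rw [← direction_affineSpan, hspan, AffineSubspace.direction_top] at h1
  rw [span_dirs hV he hx, h1]
  rfl

end Polytopes

/-- For every `d ≥ 4` there is no full-dimensional strictly bipartite
convex polytope in `ℝ^d`. -/
theorem no_strictly_bipartite_of_dim_ge_four {d : ℕ} (hd : 4 ≤ d) :
    ¬ ∃ P : Set (Euc d), IsPolytope P ∧ FullDim P ∧ IsStrictlyBipartite P := by
  rintro ⟨_, ⟨S, rfl⟩, hfull, V1, V2, r₁, r₂, ℓ, ⟨-, hlen, hunion, hdisj, hbip, hr₁, -, hV1, hV2⟩,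
    hlt⟩
  have hhull := convexHull_extremePoints_convexHull (E := Euc d) S.finite_toSet
  have hfin := finite_extremePoints_convexHull (E := Euc d) S.finite_toSet
  have hexp := exposedPoints_extremePoints (E := Euc d) S.finite_toSet
  set V := extremePoints ℝ (convexHull ℝ (S : Set (Euc d))) with hV
  have hspan : ∀ x ∈ V, Module.finrank ℝ (Submodule.span ℝ (dirs V x)) = d := fun x hx => by
    rw [span_dirs_eq_top hfin hexp (by rw [hhull]; exact hfull) hx, finrank_top,
      finrank_euclideanSpace_fin]
  have hedge : ∀ x y, Adj V x y → IsEdge (convexHull ℝ (S : Set (Euc d))) x y := fun x y hxy =>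
    ⟨hxy.2.2.1, by rw [← hhull]; exact hxy.isExposed⟩
  have hA : ∀ x ∈ V, x ∈ V1 → ⟪x, x⟫ = r₁ ^ 2 := fun x _ hx => by
    rw [real_inner_self_eq_norm_sq, hV1 x hx]
  have hB : ∀ x ∈ V, x ∉ V1 → ⟪x, x⟫ = r₂ ^ 2 := fun x hxV hx => by
    rw [real_inner_self_eq_norm_sq, hV2 x ((hunion ▸ hxV : x ∈ V1 ∪ V2).resolve_left hx)]
  have hmem : ∀ x y, Adj V x y → (x ∈ V1 ↔ y ∉ V1) := fun x y hxy => by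
    have h1 : x ∈ V1 → x ∉ V2 := fun h => Set.disjoint_left.1 hdisj h
    have h2 : y ∈ V1 → y ∉ V2 := fun h => Set.disjoint_left.1 hdisj h
    have h3 := hbip x y (hedge x y hxy)
    tauto
  have hadj : ∀ x y, Adj V x y → ⟪x, y⟫ = (r₁ ^ 2 + r₂ ^ 2 - ℓ ^ 2) / 2 := fun x y hxy => by
    have h1 := norm_sub_sq_real x y
    rw [hlen x y (hedge x y hxy)] at h1
    rcases hbip x y (hedge x y hxy) with ⟨hx, hy⟩ | ⟨hx, hy⟩
    · rw [hV1 x hx, hV2 y hy] at h1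
      linarith
    · rw [hV2 x hx, hV1 y hy] at h1
      linarith
  obtain ⟨v, w, hvw, hv1⟩ : ∃ v w, Adj V v w ∧ v ∈ V1 := by
    have hne : V.Nonempty := by
      rw [nonempty_iff_ne_empty]
      intro h0
      rw [FullDim, ← hhull, h0, convexHull_empty, AffineSubspace.span_empty] at hfull
      exact AffineSubspace.bot_ne_top _ _ _ hfull
    obtain ⟨x, hx⟩ := hne
    obtain ⟨y, hxy⟩ : ∃ y, Adj V x y := by
      by_contra! hcon
      have h1 := hspan x hx
      have h2 : dirs V x = ∅ := by simp [dirs, hcon]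
      rw [h2, Submodule.span_empty, finrank_bot] at h1
      omega
    rcases hbip x y (hedge x y hxy) with h1 | h1
    exacts [⟨x, y, hxy, h1.1⟩, ⟨y, x, hxy.symm, h1.2⟩]
  have hconfig : BipartiteConfig V V1 (r₁ ^ 2) (r₂ ^ 2) ((r₁ ^ 2 + r₂ ^ 2 - ℓ ^ 2) / 2) :=
    { finite := hfin
      exposed := hexp
      inner_self_of_mem := hA
      inner_self_of_notMem := hB
      inner_of_adj := hadj
      mem_iff_of_adj := hmem
      lt_left := BipartiteConfig.lt_of_one_lt_finrank hfin hexp hA hadj hmem hvw hv1 (by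
        rw [hspan w hvw.2.1]
        omega)
      lt_right := pow_lt_pow_left₀ hlt hr₁.le two_ne_zero }
  have h4 := hconfig.finrank_lt_four hvw.1 hv1
  rw [hspan v hvw.1] at h4
  omega
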